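/- One has the exact evaluation ∫₀^{π/2} ∫₀^θ cot θ · cot α · F_∞(α) · (F_∞(θ)·F_∞(π−θ−α) − F_∞(π−θ)·F_∞(θ−α)) dα dθ = (π²/(6c₀))·J₁(c₀). Here the integrand extends continuously to α = 0, since the bracketed factor vanishes there. (Lemma 4.8 (lem:besselcotintegral) of the paper, needed to compute the scaling constants.) -/

import Mathlib

open MeasureTheory Real

noncomputable def J0 (x : ℝ) : ℝ :=
  ∑' k : ℕ, (-1 : ℝ) ^ k * (x / 2) ^ (2 * k) / ((Nat.factorial k : ℝ)) ^ 2

noncomputable def J1 (x : ℝ) : ℝ :=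
  ∑' k : ℕ, (-1 : ℝ) ^ k * (x / 2) ^ (2 * k + 1) /
    ((Nat.factorial k : ℝ) * (Nat.factorial (k + 1) : ℝ))

noncomputable def c0 : ℝ := sInf {x : ℝ | 0 < x ∧ J0 x = 0}

/-- `F_∞(θ) = J₀(θ c₀/π)`. -/
noncomputable def Finf (θ : ℝ) : ℝ := J0 (θ * c0 / Real.pi)

open Filter Topology

/-- The coefficients of `J0 x = ∑ besselCoeff k * x ^ (2 * k) / (2 * k)!`. -/
noncomputable def besselCoeff (k : ℕ) : ℝ :=
  (-1) ^ k * ((2 * k).factorial : ℝ) / (4 ^ k * (k.factorial : ℝ) ^ 2)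

theorem besselCoeff_zero : besselCoeff 0 = 1 := by simp [besselCoeff]

theorem besselCoeff_succ (k : ℕ) :
    2 * (k + 1) * besselCoeff (k + 1) = -((2 * k + 1) * besselCoeff k) := by
  have h : (2 * (k + 1)).factorial = (2 * k + 2) * ((2 * k + 1) * (2 * k).factorial) := by
    rw [show 2 * (k + 1) = 2 * k + 1 + 1 by ring, Nat.factorial_succ, Nat.factorial_succ]
  have hk : (k.factorial : ℝ) ≠ 0 := by positivity
  have hk' : (k + 1 : ℝ) ≠ 0 := by positivity
  rw [besselCoeff, besselCoeff, h, Nat.factorial_succ]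
  push_cast
  field_simp
  ring

theorem abs_besselCoeff_le_one (k : ℕ) : |besselCoeff k| ≤ 1 := by
  induction k with
  | zero => simp [besselCoeff_zero]
  | succ k ih =>
    have h := congrArg abs (besselCoeff_succ k)
    rw [abs_neg, abs_mul, abs_mul (2 * (k : ℝ) + 1), abs_of_pos (show 0 < 2 * ((k : ℝ) + 1) by positivity),
      abs_of_pos (show 0 < 2 * (k : ℝ) + 1 by positivity)] at h
    have hk : (0 : ℝ) ≤ k := k.cast_nonneg
    nlinarith [abs_nonneg (besselCoeff (k + 1)), abs_nonneg (besselCoeff k)]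

theorem sum_antidiagonal_besselCoeff_mul (n : ℕ) :
    ∑ p ∈ Finset.HasAntidiagonal.antidiagonal n, besselCoeff p.1 * besselCoeff p.2 = (-1) ^ n := by
  induction n with
  | zero => simp [besselCoeff_zero]
  | succ n ih =>
    have weighted (m : ℕ) : 2 * ∑ p ∈ Finset.HasAntidiagonal.antidiagonal m,
        (p.1 : ℝ) * (besselCoeff p.1 * besselCoeff p.2) =
        m * ∑ p ∈ Finset.HasAntidiagonal.antidiagonal m, besselCoeff p.1 * besselCoeff p.2 := by
      rw [two_mul]
      nth_rewrite 2 [← Finset.Nat.sum_antidiagonal_swap]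
      rw [← Finset.sum_add_distrib, Finset.mul_sum]
      refine Finset.sum_congr rfl fun p hp => ?_
      rw [← Finset.HasAntidiagonal.mem_antidiagonal.1 hp]
      simp only [Prod.fst_swap, Prod.snd_swap]
      push_cast
      ring
    have h1 := weighted (n + 1)
    rw [Finset.Nat.antidiagonal_succ, Finset.sum_cons, Finset.sum_map,
      ← Finset.Nat.antidiagonal_succ] at h1
    have h2 : 2 * ∑ p ∈ Finset.HasAntidiagonal.antidiagonal n,
        ((p.1 + 1 : ℕ) : ℝ) * (besselCoeff (p.1 + 1) * besselCoeff p.2) =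
        -(2 * ∑ p ∈ Finset.HasAntidiagonal.antidiagonal n, (p.1 : ℝ) * (besselCoeff p.1 * besselCoeff p.2))
        - ∑ p ∈ Finset.HasAntidiagonal.antidiagonal n, besselCoeff p.1 * besselCoeff p.2 := by
      rw [Finset.mul_sum, Finset.mul_sum, ← Finset.sum_neg_distrib, ← Finset.sum_sub_distrib]
      refine Finset.sum_congr rfl fun p _ => ?_
      push_cast
      linear_combination besselCoeff p.2 * besselCoeff_succ p.1
    rw [weighted, ih] at h2
    have hn : ((n + 1 : ℕ) : ℝ) ≠ 0 := by positivity
    apply mul_left_cancel₀ hn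
    rw [← h1]
    simp only [Function.Embedding.prodMap, Function.Embedding.coeFn_mk, Prod.map_fst,
      Prod.map_snd, Function.Embedding.refl_apply, Nat.succ_eq_add_one, Nat.cast_zero, zero_mul,
      zero_add]
    rw [h2]
    push_cast
    ring

theorem sum_antidiagonal_besselCoeff_mul_neg_one_pow (n : ℕ) :
    ∑ p ∈ Finset.HasAntidiagonal.antidiagonal n, besselCoeff p.1 * (-1) ^ p.2 = (2 * n + 1) * besselCoeff n := by
  induction n with
  | zero => simp [besselCoeff_zero]
  | succ n ih =>
    rw [Finset.Nat.sum_antidiagonal_succ']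
    have : ∑ p ∈ Finset.HasAntidiagonal.antidiagonal n, besselCoeff p.1 * (-1) ^ (p.2 + 1) =
        -((2 * n + 1) * besselCoeff n) := by
      rw [← ih, ← Finset.sum_neg_distrib]
      exact Finset.sum_congr rfl fun p _ => by ring
    simp only [this]
    push_cast
    linear_combination -besselCoeff_succ n

theorem summable_even_pow_div_factorial (x : ℝ) (p : ℕ) :
    Summable fun k : ℕ => x ^ (2 * k + p) / ((2 * k + p).factorial : ℝ) :=
  (Real.summable_pow_div_factorial x).comp_injective
    (i := fun k : ℕ => 2 * k + p) fun a b h => by simp only at h; omega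

theorem abs_mul_pow_div_factorial_le {a : ℕ → ℝ} (ha : ∀ k, |a k| ≤ 1) {t x : ℝ}
    (h : |t| ≤ x) (p k : ℕ) :
    ‖a k * (t ^ (2 * k + p) / ((2 * k + p).factorial : ℝ))‖ ≤
      x ^ (2 * k + p) / ((2 * k + p).factorial : ℝ) := by
  rw [Real.norm_eq_abs, abs_mul, abs_div, abs_pow, Nat.abs_cast]
  calc _ ≤ 1 * (|t| ^ (2 * k + p) / ((2 * k + p).factorial : ℝ)) := by gcongr; exact ha k
    _ ≤ _ := by rw [one_mul]; gcongr

theorem integral_pow_div_factorial_mul_sub_pow (x : ℝ) (m n : ℕ) :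
    ∫ t in (0 : ℝ)..x, t ^ m / (m.factorial : ℝ) * ((x - t) ^ n / (n.factorial : ℝ)) =
      x ^ (m + n + 1) / ((m + n + 1).factorial : ℝ) := by
  induction n generalizing m with
  | zero =>
    simp only [pow_zero, Nat.factorial_zero, Nat.cast_one, div_one, mul_one, add_zero]
    rw [intervalIntegral.integral_div, integral_pow, Nat.factorial_succ]
    push_cast
    field_simp
    simp
  | succ n ih =>
    have hu (t : ℝ) : HasDerivAt (fun t : ℝ => (x - t) ^ (n + 1) / ((n + 1).factorial : ℝ))
        (-((x - t) ^ n / (n.factorial : ℝ))) t := by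
      refine ((((hasDerivAt_id t).const_sub x).pow (n + 1)).div_const
        ((n + 1).factorial : ℝ)).congr_deriv ?_
      rw [Nat.factorial_succ]
      push_cast
      simp
      field_simp
    have hv (t : ℝ) : HasDerivAt (fun t : ℝ => t ^ (m + 1) / ((m + 1).factorial : ℝ))
        (t ^ m / (m.factorial : ℝ)) t := by
      refine (((hasDerivAt_id t).pow (m + 1)).div_const ((m + 1).factorial : ℝ)).congr_deriv ?_
      rw [Nat.factorial_succ]
      push_cast
      simp
      field_simp
    have h := intervalIntegral.integral_mul_deriv_eq_deriv_mul (a := 0) (b := x)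
      (fun t _ => hu t) (fun t _ => hv t)
      (Continuous.intervalIntegrable (by fun_prop) _ _)
      (Continuous.intervalIntegrable (by fun_prop) _ _)
    have h' := ih (m + 1)
    simp only [sub_self, ne_eq, Nat.add_eq_zero_iff, one_ne_zero, and_false, not_false_eq_true,
      zero_pow, zero_div, zero_mul, mul_zero, zero_sub, neg_mul,
      intervalIntegral.integral_neg, neg_neg] at h
    rw [show m + (n + 1) + 1 = m + 1 + n + 1 by ring, ← h',
      intervalIntegral.integral_congr fun t _ => mul_comm _ _, h]
    exact intervalIntegral.integral_congr fun t _ => mul_comm _ _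

/-- Term-by-term convolution of an even power series with an even or odd one. -/
theorem hasSum_integral_mul_comp_sub {a b : ℕ → ℝ} (ha : ∀ k, |a k| ≤ 1) (hb : ∀ k, |b k| ≤ 1)
    (p : ℕ) {f g : ℝ → ℝ}
    (hf : ∀ x, HasSum (fun k => a k * (x ^ (2 * k + 0) / ((2 * k + 0).factorial : ℝ))) (f x))
    (hg : ∀ x, HasSum (fun k => b k * (x ^ (2 * k + p) / ((2 * k + p).factorial : ℝ))) (g x))
    {x : ℝ} (hx : 0 ≤ x) :
    HasSum (fun n => (∑ q ∈ Finset.HasAntidiagonal.antidiagonal n, a q.1 * b q.2) *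
      (x ^ (2 * n + p + 1) / ((2 * n + p + 1).factorial : ℝ)))
      (∫ t in (0 : ℝ)..x, f t * g (x - t)) := by
  have hbound := (summable_even_pow_div_factorial x 0).mul_of_nonneg
    (summable_even_pow_div_factorial x p) (fun k => by positivity) (fun k => by positivity)
  have habs {t : ℝ} (ht : t ∈ Set.uIoc 0 x) : |t| ≤ x ∧ |x - t| ≤ x := by
    rw [Set.uIoc_of_le hx] at ht
    exact ⟨abs_le.2 ⟨by linarith [ht.1], ht.2⟩, abs_le.2 ⟨by linarith [ht.2], by linarith [ht.1]⟩⟩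
  have key := intervalIntegral.hasSum_integral_of_dominated_convergence (μ := volume)
    (a := 0) (b := x) (ι := ℕ × ℕ)
    (F := fun q t => a q.1 * (t ^ (2 * q.1 + 0) / ((2 * q.1 + 0).factorial : ℝ)) *
      (b q.2 * ((x - t) ^ (2 * q.2 + p) / ((2 * q.2 + p).factorial : ℝ))))
    (f := fun t => f t * g (x - t))
    (fun q _ => x ^ (2 * q.1 + 0) / ((2 * q.1 + 0).factorial : ℝ) *
      (x ^ (2 * q.2 + p) / ((2 * q.2 + p).factorial : ℝ)))
    (fun q => (Continuous.aestronglyMeasurable (by fun_prop)))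
    (fun q => .of_forall fun t ht => by
      rw [norm_mul]
      exact mul_le_mul (abs_mul_pow_div_factorial_le ha (habs ht).1 _ _)
        (abs_mul_pow_div_factorial_le hb (habs ht).2 _ _) (norm_nonneg _) (by positivity))
    (.of_forall fun t _ => hbound)
    intervalIntegrable_const
    (.of_forall fun t ht => (hf t).mul (hg (x - t)) <| .of_norm <| .of_nonneg_of_le
      (fun _ => norm_nonneg _) (fun q => by
        rw [norm_mul]
        exact mul_le_mul (abs_mul_pow_div_factorial_le ha (habs ht).1 _ _)
          (abs_mul_pow_div_factorial_le hb (habs ht).2 _ _) (norm_nonneg _) (by positivity))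
      hbound)
  refine HasSum.sigma (Finset.HasAntidiagonal.sigmaAntidiagonalEquivProd.hasSum_iff.2 key) fun n => ?_
  convert! hasSum_fintype _ using 1
  rw [Finset.sum_mul, ← Finset.sum_attach, ← Finset.univ_eq_attach]
  refine Finset.sum_congr rfl fun q _ => ?_
  have hq := Finset.HasAntidiagonal.mem_antidiagonal.1 q.2
  simp only [Function.comp, Finset.HasAntidiagonal.sigmaAntidiagonalEquivProd_apply]
  have := integral_pow_div_factorial_mul_sub_pow x (2 * q.1.1 + 0) (2 * q.1.2 + p)
  rw [show 2 * q.1.1 + 0 + (2 * q.1.2 + p) + 1 = 2 * n + p + 1 by omega] at this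
  rw [← this, ← intervalIntegral.integral_const_mul]
  exact intervalIntegral.integral_congr fun t _ => by ring

theorem hasSum_J0 (x : ℝ) :
    HasSum (fun k => besselCoeff k * (x ^ (2 * k + 0) / ((2 * k + 0).factorial : ℝ))) (J0 x) := by
  have h : Summable fun k => besselCoeff k * (x ^ (2 * k + 0) / ((2 * k + 0).factorial : ℝ)) :=
    .of_norm_bounded (summable_even_pow_div_factorial |x| 0)
      fun k => abs_mul_pow_div_factorial_le abs_besselCoeff_le_one le_rfl 0 k
  convert! h.hasSum using 1
  refine tsum_congr fun k => ?_
  rw [besselCoeff, div_pow, pow_mul 2]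
  have : ((2 * k).factorial : ℝ) ≠ 0 := by positivity
  norm_num
  field_simp

theorem integral_J0_mul_J0_sub {x : ℝ} (hx : 0 ≤ x) :
    ∫ t in (0 : ℝ)..x, J0 t * J0 (x - t) = Real.sin x := by
  have h := hasSum_integral_mul_comp_sub abs_besselCoeff_le_one abs_besselCoeff_le_one 0
    hasSum_J0 hasSum_J0 hx
  simp only [sum_antidiagonal_besselCoeff_mul] at h
  exact h.unique (by simpa [mul_div_assoc] using Real.hasSum_sin x)

theorem integral_J0_mul_sin_sub {x : ℝ} (hx : 0 ≤ x) :
    ∫ t in (0 : ℝ)..x, J0 t * Real.sin (x - t) = x * J1 x := by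
  have h := hasSum_integral_mul_comp_sub abs_besselCoeff_le_one
    (b := fun k => (-1) ^ k) (by simp) 1
    hasSum_J0 (fun x => by simpa [mul_div_assoc] using Real.hasSum_sin x) hx
  simp only [sum_antidiagonal_besselCoeff_mul_neg_one_pow] at h
  rw [J1, ← tsum_mul_left, ← h.tsum_eq]
  refine tsum_congr fun k => ?_
  rw [besselCoeff, div_pow, pow_succ 2, pow_mul 2, show 2 * k + 1 + 1 = (2 * k + 1) + 1 by ring,
    Nat.factorial_succ, Nat.factorial_succ (2 * k), Nat.factorial_succ k]
  push_cast
  norm_num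
  field_simp
  ring

theorem exists_abs_J0_sub_le (R : ℝ) :
    ∃ L, 0 ≤ L ∧ ∀ x y, |x| ≤ R → |y| ≤ R → |J0 x - J0 y| ≤ L * |x - y| := by
  wlog hR : 1 ≤ R generalizing R
  · obtain ⟨L, h0, h⟩ := this 1 le_rfl
    exact ⟨L, h0, fun x y hx hy => h x y (by linarith) (by linarith)⟩
  have hs := summable_even_pow_div_factorial (2 * R) 0
  refine ⟨∑' k : ℕ, (2 * R) ^ (2 * k + 0) / ((2 * k + 0).factorial : ℝ),
    tsum_nonneg fun k => by positivity, fun x y hx hy => ?_⟩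
  have h := ((hasSum_J0 x).sub (hasSum_J0 y))
  refine (h.norm_le_of_bounded (hs.hasSum.mul_right |x - y|) fun k => ?_ :)
  rw [← mul_sub, ← sub_div, Real.norm_eq_abs, abs_mul, abs_div, Nat.abs_cast, add_zero]
  have h1 := abs_pow_sub_pow_le x y (2 * k)
  have h2 : ((2 * k : ℕ) : ℝ) ≤ 2 ^ (2 * k) := by exact_mod_cast Nat.lt_two_pow_self.le
  have h3 : max |x| |y| ^ (2 * k - 1) ≤ R ^ (2 * k) :=
    (pow_le_pow_left₀ (by positivity) (max_le hx hy) _).trans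
      (pow_le_pow_right₀ hR (Nat.sub_le _ _))
  calc _ ≤ 1 * ((|x - y| * 2 ^ (2 * k) * R ^ (2 * k)) / ((2 * k).factorial : ℝ)) := by
        gcongr
        · exact abs_besselCoeff_le_one k
        · refine h1.trans ?_
          gcongr
    _ = _ := by rw [mul_pow]; ring

theorem continuous_J0 : Continuous J0 := by
  rw [continuous_iff_continuousAt]
  intro x
  obtain ⟨L, hL, h⟩ := exists_abs_J0_sub_le (|x| + 1)
  rw [ContinuousAt, tendsto_iff_dist_tendsto_zero]
  have h0 : Tendsto (fun y => L * |y - x|) (𝓝 x) (𝓝 0) := by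
    have : Continuous fun y => L * |y - x| := by fun_prop
    simpa using this.tendsto x
  refine squeeze_zero' (.of_forall fun _ => dist_nonneg) ?_ h0
  filter_upwards [Metric.ball_mem_nhds x one_pos] with y hy
  rw [Metric.mem_ball, Real.dist_eq] at hy
  exact h y x (by have := abs_add_le (y - x) x; rw [sub_add_cancel] at this; linarith) (by linarith)

theorem J0_zero : J0 0 = 1 := by
  refine (hasSum_J0 0).unique ?_
  convert! hasSum_ite_eq 0 (1 : ℝ) using 2 with k
  rcases k with _ | k <;> simp [besselCoeff_zero]

theorem exists_pos_J0_eq_zero : ∃ x, 0 < x ∧ J0 x = 0 := by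
  by_contra! hne
  have hpos (x : ℝ) (hx : 0 ≤ x) : 0 < J0 x := by
    by_contra! hx'
    obtain ⟨y, hy, hy0⟩ := intermediate_value_Icc' hx continuous_J0.continuousOn
      ⟨hx', J0_zero.symm ▸ zero_le_one⟩
    rcases hy.1.eq_or_lt with rfl | h
    · simp [J0_zero] at hy0
    · exact hne y h hy0
  have h := integral_J0_mul_J0_sub (x := π + π / 2) (by positivity)
  have h' : 0 ≤ ∫ t in (0 : ℝ)..(π + π / 2), J0 t * J0 (π + π / 2 - t) :=
    intervalIntegral.integral_nonneg (by positivity) fun t ht =>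
      (mul_pos (hpos t ht.1) (hpos _ (by linarith [ht.2]))).le
  rw [h, add_comm, Real.sin_add_pi, Real.sin_pi_div_two] at h'
  linarith

theorem c0_pos_and_J0_c0 : 0 < c0 ∧ J0 c0 = 0 := by
  have hset : {x : ℝ | 0 < x ∧ J0 x = 0} = {x | 0 ≤ x ∧ J0 x = 0} := by
    ext x
    refine ⟨fun h => ⟨h.1.le, h.2⟩, fun h => ⟨h.1.lt_of_ne ?_, h.2⟩⟩
    rintro rfl
    simpa [J0_zero] using h.2
  have hclosed : IsClosed {x : ℝ | 0 < x ∧ J0 x = 0} := by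
    rw [hset]
    exact (isClosed_le continuous_const continuous_id).inter
      (isClosed_eq continuous_J0 continuous_const)
  exact hclosed.csInf_mem exists_pos_J0_eq_zero ⟨0, fun x hx => hx.1.le⟩

theorem setIntegral_comp_involutive {X : Type*} [MeasurableSpace X] {μ : Measure X} {σ : X → X}
    (hσ : MeasurePreserving σ μ μ) (hi : Function.Involutive σ) (s : Set X) (f : X → ℝ) :
    ∫ x in σ ⁻¹' s, f (σ x) ∂μ = ∫ x in s, f x ∂μ :=
  hσ.setIntegral_preimage_emb
    (MeasurableEquiv.ofInvolutive σ hi hσ.measurable).measurableEmbedding f s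

theorem measurePreserving_swap_real : MeasurePreserving (Prod.swap : ℝ × ℝ → ℝ × ℝ) :=
  Measure.measurePreserving_swap

theorem measurePreserving_third_angle :
    MeasurePreserving (fun p : ℝ × ℝ => (p.1, π - p.1 - p.2)) := by
  have h := ((MeasurePreserving.id volume).prod (Measure.measurePreserving_sub_left volume π)).comp
    (measurePreserving_prod_add (volume : Measure ℝ) (volume : Measure ℝ))
  simpa [Function.comp_def, Prod.map, sub_sub, Measure.volume_eq_prod] using h

theorem measurePreserving_supplement_fst :
    MeasurePreserving (fun p : ℝ × ℝ => (π - p.1, p.2)) :=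
  (Measure.measurePreserving_sub_left volume π).prod (MeasurePreserving.id volume)

theorem measure_diagonal_eq_zero : volume {p : ℝ × ℝ | p.1 = p.2} = 0 := by
  have h := (measurePreserving_prod_sub (volume : Measure ℝ) (volume : Measure ℝ)).measure_preimage
    (s := Set.univ ×ˢ {0}) (MeasurableSet.univ.prod (measurableSet_singleton 0)).nullMeasurableSet
  rw [Measure.prod_prod, Real.volume_singleton, mul_zero] at h
  rw [Measure.volume_eq_prod]
  convert! h using 2
  ext p
  simp [sub_eq_zero, eq_comm]

theorem measurable_cot : Measurable Real.cot := by
  rw [show Real.cot = fun x => Real.cos x / Real.sin x from funext Real.cot_eq_cos_div_sin]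
  fun_prop

theorem cot_pi_sub (x : ℝ) : Real.cot (π - x) = -Real.cot x := by
  simp [Real.cot_eq_cos_div_sin, Real.cos_pi_sub, Real.sin_pi_sub, neg_div]

theorem cot_nonneg_and_le_inv {x : ℝ} (h0 : 0 < x) (h1 : x < π / 2) :
    0 ≤ Real.cot x ∧ Real.cot x ≤ x⁻¹ := by
  have h := Real.lt_tan h0 h1
  rw [← Real.tan_inv_eq_cot]
  exact ⟨inv_nonneg.2 (h0.trans h).le, inv_anti₀ h0 h.le⟩

theorem cot_mul_cot_cyclic {x y : ℝ} (hx : Real.sin x ≠ 0) (hy : Real.sin y ≠ 0)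
    (hz : Real.sin (π - x - y) ≠ 0) :
    Real.cot x * Real.cot y + Real.cot x * Real.cot (π - x - y) +
      Real.cot (π - x - y) * Real.cot y = 1 := by
  rw [sub_sub, Real.sin_pi_sub, Real.sin_add] at hz
  simp only [Real.cot_eq_cos_div_sin, sub_sub, Real.cos_pi_sub, Real.sin_pi_sub, Real.cos_add,
    Real.sin_add]
  field_simp
  ring

/-- Pairs of angles which, together with the third angle of a triangle, are at least `ε`. -/
def truncatedTriangle (ε : ℝ) : Set (ℝ × ℝ) := {p | ε ≤ p.1 ∧ ε ≤ p.2 ∧ p.1 + p.2 ≤ π - ε}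

/-- Pairs `(θ, α)` with `0 < α < θ < π / 2`. -/
def acuteTriangle : Set (ℝ × ℝ) := {p | p.1 ∈ Set.Ioo 0 (π / 2) ∧ p.2 ∈ Set.Ioo 0 p.1}

/-- The product of `F` over the three angles of a triangle. -/
noncomputable def angleProduct (F : ℝ → ℝ) (p : ℝ × ℝ) : ℝ := F p.1 * F p.2 * F (π - p.1 - p.2)

/-- `angleProduct` weighted by two of the cotangents. -/
noncomputable def cotKernel (F : ℝ → ℝ) (p : ℝ × ℝ) : ℝ :=
  Real.cot p.1 * Real.cot p.2 * angleProduct F p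

/-- The reflection of `cotKernel` under `θ ↦ π - θ`, up to sign. -/
noncomputable def reflectedCotKernel (F : ℝ → ℝ) (p : ℝ × ℝ) : ℝ :=
  Real.cot p.1 * Real.cot p.2 * (F (π - p.1) * F p.2 * F (p.1 - p.2))

theorem isClosed_truncatedTriangle (ε : ℝ) : IsClosed (truncatedTriangle ε) :=
  (isClosed_le continuous_const continuous_fst).inter
    ((isClosed_le continuous_const continuous_snd).inter
      (isClosed_le (continuous_fst.add continuous_snd) continuous_const))

theorem isCompact_truncatedTriangle (ε : ℝ) : IsCompact (truncatedTriangle ε) := by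
  refine (isCompact_Icc (a := ((ε, ε) : ℝ × ℝ)) (b := (π - ε - ε, π - ε - ε))).of_isClosed_subset
    (isClosed_truncatedTriangle ε) fun p hp => ?_
  obtain ⟨h1, h2, h3⟩ := hp
  exact ⟨⟨h1, h2⟩, ⟨by simp only; linarith, by simp only; linarith⟩⟩

theorem measurableSet_acuteTriangle : MeasurableSet acuteTriangle := by
  unfold acuteTriangle
  simp only [Set.mem_Ioo]
  measurability

theorem sin_ne_zero_of_mem_truncatedTriangle {ε : ℝ} (hε : 0 < ε) {p : ℝ × ℝ}
    (hp : p ∈ truncatedTriangle ε) :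
    Real.sin p.1 ≠ 0 ∧ Real.sin p.2 ≠ 0 ∧ Real.sin (π - p.1 - p.2) ≠ 0 := by
  obtain ⟨h1, h2, h3⟩ := hp
  refine ⟨?_, ?_, ?_⟩ <;> exact (Real.sin_pos_of_pos_of_lt_pi (by linarith) (by linarith)).ne'

theorem setIntegral_triangle_eq {b : ℝ} (hb : 0 ≤ b) {g : ℝ → ℝ} (hg : Measurable g)
    (hg0 : ∀ x ∈ Set.Ioo 0 b, 0 ≤ g x) {h : ℝ × ℝ → ℝ}
    (hi : IntegrableOn h {p | p.1 ∈ Set.Ioo 0 b ∧ p.2 ∈ Set.Ioo 0 (g p.1)}) :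
    ∫ p in {p | p.1 ∈ Set.Ioo 0 b ∧ p.2 ∈ Set.Ioo 0 (g p.1)}, h p =
      ∫ x in (0 : ℝ)..b, ∫ y in (0 : ℝ)..g x, h (x, y) := by
  have hm : MeasurableSet {p : ℝ × ℝ | p.1 ∈ Set.Ioo 0 b ∧ p.2 ∈ Set.Ioo 0 (g p.1)} := by
    simp only [Set.mem_Ioo]
    measurability
  rw [← integral_indicator hm, Measure.volume_eq_prod, integral_prod _ (by
    rw [← Measure.volume_eq_prod]; exact hi.integrable_indicator hm),
    intervalIntegral.integral_of_le hb, integral_Ioc_eq_integral_Ioo,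
    ← integral_indicator measurableSet_Ioo]
  congr 1
  ext x
  by_cases hx : x ∈ Set.Ioo 0 b
  · rw [Set.indicator_of_mem hx, intervalIntegral.integral_of_le (hg0 x hx),
      integral_Ioc_eq_integral_Ioo, ← integral_indicator measurableSet_Ioo]
    congr 1
    ext y
    by_cases hy : y ∈ Set.Ioo 0 (g x)
    · rw [Set.indicator_of_mem hy, Set.indicator_of_mem (by exact ⟨hx, hy⟩)]
    · rw [Set.indicator_of_notMem hy, Set.indicator_of_notMem (by exact fun h => hy h.2)]
  · rw [Set.indicator_of_notMem hx]
    simp_rw [Set.indicator_of_notMem (show (x, _) ∉ {p : ℝ × ℝ | p.1 ∈ Set.Ioo 0 b ∧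
      p.2 ∈ Set.Ioo 0 (g p.1)} from fun h => hx h.1)]
    simp

theorem integrableOn_div_fst_acuteTriangle (C : ℝ) :
    IntegrableOn (fun p : ℝ × ℝ => C / p.1) acuteTriangle := by
  have hm := measurableSet_acuteTriangle
  rw [← integrable_indicator_iff hm, Measure.volume_eq_prod, integrable_prod_iff
    ((Measurable.indicator (by fun_prop) hm).aestronglyMeasurable)]
  have slice (x y : ℝ) : acuteTriangle.indicator (fun p : ℝ × ℝ => C / p.1) (x, y) =
      (Set.Ioo 0 (π / 2)).indicator
        (fun x => (Set.Ioo 0 x).indicator (fun _ => C / x) y) x := by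
    by_cases hx : x ∈ Set.Ioo 0 (π / 2) <;> by_cases hy : y ∈ Set.Ioo 0 x <;>
      simp only [Set.indicator, acuteTriangle, Set.mem_ofPred_eq, hx, hy, and_self, and_true,
        and_false, if_true, if_false]
  constructor
  · refine .of_forall fun x => ?_
    simp_rw [slice]
    by_cases hx : x ∈ Set.Ioo 0 (π / 2)
    · simp only [Set.indicator_of_mem hx]
      rw [integrable_indicator_iff measurableSet_Ioo]
      exact integrableOn_const (by simp)
    · simp [Set.indicator_of_notMem hx]
  · have : (fun x => ∫ y, ‖acuteTriangle.indicator (fun p : ℝ × ℝ => C / p.1) (x, y)‖) =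
        (Set.Ioo 0 (π / 2)).indicator fun _ => |C| := by
      ext x
      simp_rw [slice]
      by_cases hx : x ∈ Set.Ioo 0 (π / 2)
      · simp only [Set.indicator_of_mem hx, norm_indicator_eq_indicator_norm]
        rw [integral_indicator measurableSet_Ioo]
        have hx0 : 0 < x := hx.1
        simp [hx0.le, abs_of_pos hx0]
        field_simp
      · simp [Set.indicator_of_notMem hx]
    rw [this, integrable_indicator_iff measurableSet_Ioo]
    exact integrableOn_const (by simp)

theorem continuous_angleProduct {F : ℝ → ℝ} (hF : Continuous F) : Continuous (angleProduct F) := by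
  unfold angleProduct
  fun_prop

theorem measurable_cotKernel {F : ℝ → ℝ} (hF : Continuous F) : Measurable (cotKernel F) :=
  ((measurable_cot.comp measurable_fst).mul (measurable_cot.comp measurable_snd)).mul
    (continuous_angleProduct hF).measurable

theorem measurable_reflectedCotKernel {F : ℝ → ℝ} (hF : Continuous F) :
    Measurable (reflectedCotKernel F) :=
  ((measurable_cot.comp measurable_fst).mul (measurable_cot.comp measurable_snd)).mul
    (by fun_prop)

theorem integrableOn_cotKernel {F : ℝ → ℝ} (hF : Continuous F) {ε : ℝ} (hε : 0 < ε) :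
    IntegrableOn (cotKernel F) (truncatedTriangle ε) := by
  refine ContinuousOn.integrableOn_compact (isCompact_truncatedTriangle ε) ?_
  have h1 := continuous_angleProduct hF
  unfold cotKernel
  simp only [Real.cot_eq_cos_div_sin]
  refine ContinuousOn.mul (ContinuousOn.mul ?_ ?_) h1.continuousOn
  · exact ContinuousOn.div (by fun_prop) (by fun_prop) fun p hp =>
      (sin_ne_zero_of_mem_truncatedTriangle hε hp).1
  · exact ContinuousOn.div (by fun_prop) (by fun_prop) fun p hp =>
      (sin_ne_zero_of_mem_truncatedTriangle hε hp).2.1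

theorem setIntegral_angleProduct_eq {F : ℝ → ℝ} (hF : Continuous F) {ε : ℝ} (hε : 0 < ε) :
    ∫ p in truncatedTriangle ε, angleProduct F p =
      3 * ∫ p in truncatedTriangle ε, cotKernel F p := by
  set T := truncatedTriangle ε
  let σ : ℝ × ℝ → ℝ × ℝ := fun p => (p.1, π - p.1 - p.2)
  let τ : ℝ × ℝ → ℝ × ℝ := fun p => (π - p.1 - p.2, p.2)
  have hσ : MeasurePreserving σ := measurePreserving_third_angle
  have hτ : MeasurePreserving τ := by
    convert measurePreserving_swap_real.comp (hσ.comp measurePreserving_swap_real) using 1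
    ext p <;> simp [σ, τ, sub_right_comm]
  have hσi : Function.Involutive σ := fun p => by simp [σ]
  have hτi : Function.Involutive τ := fun p => by ext <;> simp [τ]; ring
  have hσT : σ ⁻¹' T = T := by
    ext p
    simp only [T, truncatedTriangle, σ, Set.mem_preimage, Set.mem_ofPred_eq]
    constructor <;> rintro ⟨h1, h2, h3⟩ <;> refine ⟨?_, ?_, ?_⟩ <;> linarith
  have hτT : τ ⁻¹' T = T := by
    ext p
    simp only [T, truncatedTriangle, τ, Set.mem_preimage, Set.mem_ofPred_eq]
    constructor <;> rintro ⟨h1, h2, h3⟩ <;> refine ⟨?_, ?_, ?_⟩ <;> linarith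
  have hi := integrableOn_cotKernel hF hε
  have h1 := setIntegral_comp_involutive hσ hσi T (cotKernel F)
  have h2 := setIntegral_comp_involutive hτ hτi T (cotKernel F)
  have hi1 : IntegrableOn (fun p => cotKernel F (σ p)) T := by
    have := (hσ.integrableOn_comp_preimage
      (MeasurableEquiv.ofInvolutive σ hσi hσ.measurable).measurableEmbedding
      (f := cotKernel F) (s := T)).2 hi
    rwa [hσT] at this
  have hi2 : IntegrableOn (fun p => cotKernel F (τ p)) T := by
    have := (hτ.integrableOn_comp_preimage
      (MeasurableEquiv.ofInvolutive τ hτi hτ.measurable).measurableEmbedding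
      (f := cotKernel F) (s := T)).2 hi
    rwa [hτT] at this
  rw [hσT] at h1
  rw [hτT] at h2
  have hsum : ∫ p in T, angleProduct F p =
      ∫ p in T, (cotKernel F p + cotKernel F (σ p) + cotKernel F (τ p)) := by
    refine setIntegral_congr_fun (isClosed_truncatedTriangle ε).measurableSet fun p hp => ?_
    obtain ⟨s1, s2, s3⟩ := sin_ne_zero_of_mem_truncatedTriangle hε hp
    have hc := cot_mul_cot_cyclic s1 s2 s3
    simp only [cotKernel, angleProduct, σ, τ, sub_sub_cancel,
      show π - (π - p.1 - p.2) - p.2 = p.1 by ring]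
    linear_combination (-(F p.1 * F p.2 * F (π - p.1 - p.2))) * hc
  rw [hsum, integral_add (by exact hi.add hi1) hi2, integral_add hi hi1, h1, h2]
  ring

theorem setIntegral_cotKernel_eq_two_mul {F : ℝ → ℝ} (hF : Continuous F) {ε : ℝ} (hε : 0 < ε) :
    ∫ p in truncatedTriangle ε, cotKernel F p =
      2 * ∫ p in truncatedTriangle ε ∩ {p | p.2 < p.1}, cotKernel F p := by
  have hi := integrableOn_cotKernel hF hε
  have hm : MeasurableSet {p : ℝ × ℝ | p.2 < p.1} := measurableSet_lt measurable_snd measurable_fst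
  rw [← integral_inter_add_sdiff hm hi, two_mul]
  congr 1
  rw [← setIntegral_comp_involutive measurePreserving_swap_real
    Prod.swap_swap (truncatedTriangle ε \ {p | p.2 < p.1}) (cotKernel F)]
  have hswap (p : ℝ × ℝ) : cotKernel F p.swap = cotKernel F p := by
    simp only [cotKernel, angleProduct, Prod.fst_swap, Prod.snd_swap, sub_right_comm π p.2]
    ring
  simp only [hswap]
  refine setIntegral_congr_set ?_
  have hd : ∀ᵐ p : ℝ × ℝ, p.1 ≠ p.2 := measure_eq_zero_iff_ae_notMem.1 measure_diagonal_eq_zero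
  filter_upwards [hd] with p hp
  refine propext ?_
  change p.swap ∈ truncatedTriangle ε ∧ ¬ (p.1 < p.2) ↔ p ∈ truncatedTriangle ε ∧ p.2 < p.1
  simp only [truncatedTriangle, Set.mem_ofPred_eq, Prod.fst_swap, Prod.snd_swap, not_lt]
  constructor
  · rintro ⟨⟨h1, h2, h3⟩, h4⟩
    exact ⟨⟨h2, h1, by linarith⟩, h4.lt_of_ne hp.symm⟩
  · rintro ⟨⟨h1, h2, h3⟩, h4⟩
    exact ⟨⟨h2, h1, by linarith⟩, h4.le⟩

/-- The cutoff of `acuteTriangle` coming from the part of `truncatedTriangle` with `θ < π / 2`. -/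
def sumCutoff (ε : ℝ) : Set (ℝ × ℝ) := {p | ε ≤ p.2 ∧ p.1 + p.2 ≤ π - ε}

/-- The cutoff of `acuteTriangle` coming from the part of `truncatedTriangle` with `θ > π / 2`,
after the reflection `θ ↦ π - θ`. -/
def diffCutoff (ε : ℝ) : Set (ℝ × ℝ) := {p | ε ≤ p.2 ∧ p.2 + ε ≤ p.1}

theorem measurableSet_sumCutoff (ε : ℝ) : MeasurableSet (sumCutoff ε) :=
  (measurableSet_le measurable_const measurable_snd).inter
    (measurableSet_le (measurable_fst.add measurable_snd) measurable_const)

theorem measurableSet_diffCutoff (ε : ℝ) : MeasurableSet (diffCutoff ε) :=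
  (measurableSet_le measurable_const measurable_snd).inter
    (measurableSet_le (measurable_snd.add measurable_const) measurable_fst)

theorem cotKernel_supplement_fst (F : ℝ → ℝ) (p : ℝ × ℝ) :
    cotKernel F (π - p.1, p.2) = -reflectedCotKernel F p := by
  simp only [cotKernel, angleProduct, reflectedCotKernel, cot_pi_sub, sub_sub_cancel]
  ring

theorem setIntegral_cotKernel_fold {F : ℝ → ℝ} (hF : Continuous F) {ε : ℝ} (hε : 0 < ε) :
    ∫ p in truncatedTriangle ε ∩ {p | p.2 < p.1}, cotKernel F p =
      ∫ p in acuteTriangle, ((sumCutoff ε).indicator (cotKernel F) p -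
        (diffCutoff ε).indicator (reflectedCotKernel F) p) := by
  have hm : MeasurableSet {p : ℝ × ℝ | p.1 < π / 2} :=
    measurableSet_lt measurable_fst measurable_const
  have hi := (integrableOn_cotKernel hF hε).mono_set
    (Set.inter_subset_left (t := {p : ℝ × ℝ | p.2 < p.1}))
  have hacute : truncatedTriangle ε ∩ {p | p.2 < p.1} ∩ {p | p.1 < π / 2} =
      acuteTriangle ∩ sumCutoff ε := by
    ext p
    simp only [truncatedTriangle, acuteTriangle, sumCutoff, Set.mem_inter_iff, Set.mem_ofPred_eq,
      Set.mem_Ioo]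
    constructor
    · rintro ⟨⟨⟨h1, h2, h3⟩, h4⟩, h5⟩
      exact ⟨⟨⟨by linarith, h5⟩, by linarith, h4⟩, h2, h3⟩
    · rintro ⟨⟨⟨h1, h5⟩, h0, h4⟩, h2, h3⟩
      exact ⟨⟨⟨by linarith, h2, h3⟩, h4⟩, h5⟩
  let ρ : ℝ × ℝ → ℝ × ℝ := fun p => (π - p.1, p.2)
  have hρi : Function.Involutive ρ := fun p => by simp [ρ]
  set B := (truncatedTriangle ε ∩ {p | p.2 < p.1}) \ {p | p.1 < π / 2}
  have hB : MeasurableSet B :=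
    ((isClosed_truncatedTriangle ε).measurableSet.inter
      (measurableSet_lt measurable_snd measurable_fst)).diff hm
  have hBi : IntegrableOn (cotKernel F) B := hi.mono_set Set.sdiff_subset
  have hmem (p : ℝ × ℝ) : p ∈ ρ ⁻¹' B ↔ p.1 ≤ π / 2 ∧ p ∈ diffCutoff ε := by
    simp only [B, ρ, truncatedTriangle, diffCutoff, Set.mem_preimage, Set.mem_sdiff,
      Set.mem_inter_iff, Set.mem_ofPred_eq, not_lt]
    constructor
    · rintro ⟨⟨⟨h1, h2, h3⟩, h4⟩, h5⟩
      exact ⟨by linarith, h2, by linarith⟩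
    · rintro ⟨h1, h2, h3⟩
      exact ⟨⟨⟨by linarith, h2, by linarith⟩, by linarith⟩, by linarith⟩
  have hsub : acuteTriangle ∩ diffCutoff ε ⊆ ρ ⁻¹' B :=
    fun p hp => (hmem p).2 ⟨hp.1.1.2.le, hp.2⟩
  have hBρ := setIntegral_comp_involutive measurePreserving_supplement_fst hρi B (cotKernel F)
  have hBρi := (measurePreserving_supplement_fst.integrableOn_comp_preimage
      (MeasurableEquiv.ofInvolutive ρ hρi
        measurePreserving_supplement_fst.measurable).measurableEmbedding).2 hBi
  simp only [Function.comp_def, cotKernel_supplement_fst] at hBρ hBρi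
  have hobtuse : ∫ p in ρ ⁻¹' B, reflectedCotKernel F p =
      ∫ p in acuteTriangle ∩ diffCutoff ε, reflectedCotKernel F p := by
    refine setIntegral_eq_of_subset_of_forall_sdiff_eq_zero
      (measurePreserving_supplement_fst.measurable hB) hsub fun p hp => ?_
    obtain ⟨h1, h2⟩ := (hmem p).1 hp.1
    have h3 : p.1 = π / 2 := by
      refine h1.eq_of_not_lt fun h => hp.2 ⟨⟨⟨?_, h⟩, ?_, ?_⟩, h2⟩ <;>
      linarith [h2.1, h2.2]
    simp [reflectedCotKernel, h3, Real.cot_eq_cos_div_sin]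
  rw [← integral_inter_add_sdiff hm hi, hacute, ← hBρ, integral_neg, hobtuse, integral_sub,
    setIntegral_indicator (measurableSet_sumCutoff ε),
    setIntegral_indicator (measurableSet_diffCutoff ε), sub_eq_add_neg]
  · change IntegrableOn ((sumCutoff ε).indicator (cotKernel F)) acuteTriangle volume
    rw [integrableOn_indicator_iff (measurableSet_sumCutoff ε), Set.inter_comm, ← hacute]
    exact hi.mono_set Set.inter_subset_left
  · change IntegrableOn ((diffCutoff ε).indicator (reflectedCotKernel F)) acuteTriangle volume
    rw [integrableOn_indicator_iff (measurableSet_diffCutoff ε), Set.inter_comm]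
    simpa using (hBρi.mono_set hsub).neg

theorem abs_cotKernel_sub_reflectedCotKernel_le {F : ℝ → ℝ} {M L : ℝ}
    (hM : ∀ x ∈ Set.Icc 0 π, |F x| ≤ M)
    (hL : ∀ x ∈ Set.Icc 0 π, ∀ y ∈ Set.Icc 0 π, |F x - F y| ≤ L * |x - y|)
    {p : ℝ × ℝ} (hp : p ∈ acuteTriangle) :
    |cotKernel F p - reflectedCotKernel F p| ≤ 2 * M ^ 2 * L / p.1 := by
  obtain ⟨x, y⟩ := p
  obtain ⟨⟨hx0, hx⟩, hy0, hy⟩ : (0 < x ∧ x < π / 2) ∧ 0 < y ∧ y < x := hp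
  have hcx := cot_nonneg_and_le_inv hx0 hx
  have hcy := cot_nonneg_and_le_inv hy0 (hy.trans hx)
  have h1 := hM x ⟨by linarith, by linarith⟩
  have h2 := hM y ⟨by linarith, by linarith⟩
  have h3 := hM (π - x) ⟨by linarith, by linarith⟩
  have h4 := hL (π - x - y) ⟨by linarith, by linarith⟩ (π - x) ⟨by linarith, by linarith⟩
  have h5 := hL x ⟨by linarith, by linarith⟩ (x - y) ⟨by linarith, by linarith⟩
  rw [sub_sub_cancel_left, abs_neg, abs_of_pos hy0] at h4
  rw [sub_sub_cancel, abs_of_pos hy0] at h5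
  have hM0 : 0 ≤ M := (abs_nonneg _).trans h1
  have hLy : 0 ≤ L * y := (abs_nonneg _).trans h4
  calc |cotKernel F (x, y) - reflectedCotKernel F (x, y)|
      = Real.cot x * Real.cot y * (|F y| * |F x * (F (π - x - y) - F (π - x)) +
          F (π - x) * (F x - F (x - y))|) := by
        rw [← abs_mul, ← abs_of_nonneg (mul_nonneg hcx.1 hcy.1), ← abs_mul]
        simp only [cotKernel, reflectedCotKernel, angleProduct]
        ring_nf
    _ ≤ x⁻¹ * y⁻¹ * (M * (M * (L * y) + M * (L * y))) := by
        gcongr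
        · exact hcy.1
        · exact hcx.2
        · exact hcy.2
        · refine (abs_add_le _ _).trans ?_
          rw [abs_mul, abs_mul]
          gcongr
    _ = 2 * M ^ 2 * L / x := by field_simp; ring

theorem abs_cotKernel_le {F : ℝ → ℝ} {M L : ℝ} (hπ : F π = 0) (hL0 : 0 ≤ L)
    (hM : ∀ x ∈ Set.Icc 0 π, |F x| ≤ M)
    (hL : ∀ x ∈ Set.Icc 0 π, ∀ y ∈ Set.Icc 0 π, |F x - F y| ≤ L * |x - y|)
    {p : ℝ × ℝ} (hp : p ∈ acuteTriangle) (h : p.1 ≤ 2 * p.2) :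
    |cotKernel F p| ≤ 3 * M ^ 2 * L / p.1 := by
  obtain ⟨x, y⟩ := p
  obtain ⟨⟨hx0, hx⟩, hy0, hy⟩ : (0 < x ∧ x < π / 2) ∧ 0 < y ∧ y < x := hp
  replace h : x ≤ 2 * y := h
  have hcx := cot_nonneg_and_le_inv hx0 hx
  have hcy := cot_nonneg_and_le_inv hy0 (hy.trans hx)
  have h1 := hM x ⟨by linarith, by linarith⟩
  have h2 := hM y ⟨by linarith, by linarith⟩
  have h3 := hL (π - x - y) ⟨by linarith, by linarith⟩ π ⟨by linarith, by linarith⟩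
  rw [hπ, sub_zero, sub_sub, sub_sub_cancel_left, abs_neg, abs_of_pos (add_pos hx0 hy0),
    ← sub_sub] at h3
  have hM0 : 0 ≤ M := (abs_nonneg _).trans h1
  calc |cotKernel F (x, y)|
      = Real.cot x * Real.cot y * (|F x| * |F y| * |F (π - x - y)|) := by
        rw [cotKernel, angleProduct, abs_mul, abs_of_nonneg (mul_nonneg hcx.1 hcy.1), abs_mul,
          abs_mul]
    _ ≤ x⁻¹ * y⁻¹ * (M * M * (L * (3 * y))) := by
        gcongr
        · exact hcy.1
        · exact hcx.2
        · exact hcy.2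
        · exact h3.trans (by gcongr; linarith)
    _ = 3 * M ^ 2 * L / x := by field_simp

/-- Folding the symmetrized integral of `angleProduct` onto `acuteTriangle`. -/
theorem integrableOn_and_setIntegral_cotKernel_sub {F : ℝ → ℝ} {L : ℝ} (hF : Continuous F)
    (hπ : F π = 0) (hL0 : 0 ≤ L)
    (hL : ∀ x ∈ Set.Icc 0 π, ∀ y ∈ Set.Icc 0 π, |F x - F y| ≤ L * |x - y|) :
    IntegrableOn (fun p => cotKernel F p - reflectedCotKernel F p) acuteTriangle ∧
    6 * ∫ p in acuteTriangle, (cotKernel F p - reflectedCotKernel F p) =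
      ∫ p in {p : ℝ × ℝ | p.1 ∈ Set.Ioo 0 π ∧ p.2 ∈ Set.Ioo 0 (π - p.1)}, angleProduct F p := by
  obtain ⟨M, hM⟩ := (isCompact_Icc (a := (0 : ℝ)) (b := π)).exists_bound_of_continuousOn
    hF.continuousOn
  simp only [Real.norm_eq_abs] at hM
  have hm := measurableSet_acuteTriangle
  have hP := measurable_cotKernel hF
  have hQ := measurable_reflectedCotKernel hF
  have hbound := integrableOn_div_fst_acuteTriangle (3 * M ^ 2 * L)
  have hdiff {p : ℝ × ℝ} (hp : p ∈ acuteTriangle) :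
      |cotKernel F p - reflectedCotKernel F p| ≤ 3 * M ^ 2 * L / p.1 := by
    refine (abs_cotKernel_sub_reflectedCotKernel_le hM hL hp).trans ?_
    have : 0 ≤ p.1 := hp.1.1.le
    gcongr
    norm_num
  refine ⟨hbound.mono' (hP.sub hQ).aestronglyMeasurable
    (ae_restrict_of_forall_mem hm fun p hp => hdiff hp), ?_⟩
  let ε : ℕ → ℝ := fun n => 1 / ((n : ℝ) + 1)
  have hε (n : ℕ) : 0 < ε n := Nat.one_div_pos_of_nat
  have hε0 : Tendsto ε atTop (𝓝 0) := tendsto_one_div_add_atTop_nhds_zero_nat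
  have hfold : Tendsto (fun n => ∫ p in acuteTriangle,
      ((sumCutoff (ε n)).indicator (cotKernel F) p -
        (diffCutoff (ε n)).indicator (reflectedCotKernel F) p)) atTop
      (𝓝 (∫ p in acuteTriangle, (cotKernel F p - reflectedCotKernel F p))) := by
    refine tendsto_integral_of_dominated_convergence (fun p => 3 * M ^ 2 * L / p.1)
      (fun n => ((hP.indicator (measurableSet_sumCutoff _)).sub
        (hQ.indicator (measurableSet_diffCutoff _))).aestronglyMeasurable) hbound
      (fun n => ae_restrict_of_forall_mem hm fun p hp => ?_)
      (ae_restrict_of_forall_mem hm fun p hp => ?_)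
    · have hp0 : 0 ≤ p.1 := hp.1.1.le
      have hp1 : p.1 < π / 2 := hp.1.2
      rw [Real.norm_eq_abs]
      by_cases hD : p ∈ diffCutoff (ε n)
      · have hS : p ∈ sumCutoff (ε n) := ⟨hD.1, by linarith [hD.2]⟩
        rw [Set.indicator_of_mem hS, Set.indicator_of_mem hD]
        exact hdiff hp
      · rw [Set.indicator_of_notMem hD, sub_zero]
        by_cases hS : p ∈ sumCutoff (ε n)
        · rw [Set.indicator_of_mem hS]
          refine abs_cotKernel_le hπ hL0 hM hL hp ?_
          by_contra! h
          exact hD ⟨hS.1, by linarith [hS.1]⟩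
        · rw [Set.indicator_of_notMem hS, abs_zero]
          positivity
    · refine tendsto_const_nhds.congr' ?_
      have hp0 : 0 < p.2 := hp.2.1
      have hp1 : p.2 < p.1 := hp.2.2
      have hp2 : p.1 < π / 2 := hp.1.2
      filter_upwards [hε0.eventually_le_const hp0, hε0.eventually_le_const (sub_pos.2 hp1)]
        with n h1 h2
      rw [Set.indicator_of_mem (show p ∈ sumCutoff (ε n) from ⟨h1, by linarith⟩),
        Set.indicator_of_mem (show p ∈ diffCutoff (ε n) from ⟨h1, by linarith⟩)]
  have hunion : ⋃ n, truncatedTriangle (ε n) =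
      {p : ℝ × ℝ | p.1 ∈ Set.Ioo 0 π ∧ p.2 ∈ Set.Ioo 0 (π - p.1)} := by
    ext p
    simp only [Set.mem_iUnion, truncatedTriangle, Set.mem_ofPred_eq, Set.mem_Ioo]
    constructor
    · rintro ⟨n, h1, h2, h3⟩
      have := hε n
      exact ⟨⟨by linarith, by linarith⟩, by linarith, by linarith⟩
    · rintro ⟨⟨h1, h2⟩, h3, h4⟩
      obtain ⟨n, hn1, hn2, hn3⟩ := ((hε0.eventually_le_const h1).and
        ((hε0.eventually_le_const h3).and (hε0.eventually_le_const (sub_pos.2 h4)))).exists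
      exact ⟨n, hn1, hn2, by linarith⟩
  have hexhaust := tendsto_setIntegral_of_monotone (f := angleProduct F) (μ := volume)
    (s := fun n => truncatedTriangle (ε n))
    (fun n => (isClosed_truncatedTriangle _).measurableSet)
    (fun m n hmn p hp => by
      have : ε n ≤ ε m := Nat.one_div_le_one_div hmn
      exact ⟨this.trans hp.1, this.trans hp.2.1, hp.2.2.trans (by linarith)⟩)
    (((continuous_angleProduct hF).continuousOn.integrableOn_compact
      (isCompact_truncatedTriangle 0)).mono_set (Set.iUnion_subset fun n p hp => by
        have := (hε n).le
        exact ⟨this.trans hp.1, this.trans hp.2.1, hp.2.2.trans (by linarith)⟩))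
  rw [hunion] at hexhaust
  refine tendsto_nhds_unique (hfold.const_mul 6) (hexhaust.congr fun n => ?_)
  rw [setIntegral_angleProduct_eq hF (hε n), setIntegral_cotKernel_eq_two_mul hF (hε n),
    setIntegral_cotKernel_fold hF (hε n)]
  ring

theorem integral_cot_mul_cot_eq {F : ℝ → ℝ} {L : ℝ} (hF : Continuous F)
    (hπ : F π = 0) (hL0 : 0 ≤ L)
    (hL : ∀ x ∈ Set.Icc 0 π, ∀ y ∈ Set.Icc 0 π, |F x - F y| ≤ L * |x - y|) :
    6 * ∫ θ in (0 : ℝ)..(π / 2), ∫ α in (0 : ℝ)..θ, Real.cot θ * Real.cot α * F α *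
        (F θ * F (π - θ - α) - F (π - θ) * F (θ - α)) =
      ∫ θ in (0 : ℝ)..π, F θ * ∫ α in (0 : ℝ)..(π - θ), F α * F (π - θ - α) := by
  obtain ⟨hi, h⟩ := integrableOn_and_setIntegral_cotKernel_sub hF hπ hL0 hL
  have h1 := setIntegral_triangle_eq (by positivity) measurable_id (fun x hx => hx.1.le) hi
  have h2 := setIntegral_triangle_eq pi_pos.le (g := fun x => π - x) (by fun_prop)
    (fun x hx => by linarith [hx.2]) (h := angleProduct F)
    (((continuous_angleProduct hF).continuousOn.integrableOn_compact
      (isCompact_truncatedTriangle 0)).mono_set fun p hp =>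
        ⟨hp.1.1.le, hp.2.1.le, by linarith [hp.2.2]⟩)
  change ∫ p in acuteTriangle, _ = _ at h1
  rw [h1, h2] at h
  convert h using 1
  · congr 1
    refine intervalIntegral.integral_congr fun θ _ => intervalIntegral.integral_congr fun α _ => ?_
    simp only [cotKernel, reflectedCotKernel, angleProduct]
    ring
  · refine intervalIntegral.integral_congr fun θ _ => ?_
    rw [← intervalIntegral.integral_const_mul]
    exact intervalIntegral.integral_congr fun α _ => by simp only [angleProduct]; ring

theorem integral_Finf_mul_Finf_sub {x : ℝ} (hx : 0 ≤ x) :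
    ∫ t in (0 : ℝ)..x, Finf t * Finf (x - t) = π / c0 * Real.sin (x * c0 / π) := by
  have hc := c0_pos_and_J0_c0.1
  have hk : c0 / π ≠ 0 := (div_pos hc pi_pos).ne'
  rw [← integral_J0_mul_J0_sub (x := x * c0 / π) (by positivity)]
  have h := intervalIntegral.integral_comp_mul_right (a := 0) (b := x)
    (fun t => J0 t * J0 (x * c0 / π - t)) hk
  rw [zero_mul, inv_div, smul_eq_mul, ← mul_div_assoc] at h
  rw [← h]
  refine intervalIntegral.integral_congr fun t _ => ?_
  simp only [Finf]
  ring_nf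

theorem integral_Finf_mul_sin :
    ∫ t in (0 : ℝ)..π, Finf t * Real.sin ((π - t) * c0 / π) = π * J1 c0 := by
  have hc := c0_pos_and_J0_c0.1
  have hk : c0 / π ≠ 0 := (div_pos hc pi_pos).ne'
  have h := intervalIntegral.integral_comp_mul_right (a := 0) (b := π)
    (fun t => J0 t * Real.sin (c0 - t)) hk
  rw [zero_mul, inv_div, smul_eq_mul, mul_div_cancel₀ _ pi_ne_zero, integral_J0_mul_sin_sub hc.le]
    at h
  rw [show π * J1 c0 = π / c0 * (c0 * J1 c0) by field_simp, ← h]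
  refine intervalIntegral.integral_congr fun t _ => ?_
  simp only [Finf]
  rw [show (π - t) * c0 / π = c0 - t * (c0 / π) by field_simp, mul_div_assoc]

/-- Lemma 4.8 (lem:besselcotintegral): the exact evaluation
`∫₀^{π/2} ∫₀^θ cot θ cot α F_∞(α) (F_∞(θ)F_∞(π−θ−α) − F_∞(π−θ)F_∞(θ−α)) dα dθ
  = (π²/(6c₀)) J₁(c₀)`. -/
theorem bessel_cot_integral :
    (∫ θ in (0:ℝ)..(Real.pi / 2), ∫ α in (0:ℝ)..θ,
        Real.cot θ * Real.cot α * Finf α *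
          (Finf θ * Finf (Real.pi - θ - α) - Finf (Real.pi - θ) * Finf (θ - α))) =
      Real.pi ^ 2 / (6 * c0) * J1 c0 := by
  obtain ⟨hc, hc0⟩ := c0_pos_and_J0_c0
  obtain ⟨L, hL0, hL⟩ := exists_abs_J0_sub_le c0
  have habs {x : ℝ} (hx : x ∈ Set.Icc 0 π) : |x * c0 / π| ≤ c0 := by
    rw [abs_of_nonneg (div_nonneg (mul_nonneg hx.1 hc.le) pi_pos.le), div_le_iff₀ pi_pos, mul_comm]
    exact mul_le_mul_of_nonneg_left hx.2 hc.le
  have h := integral_cot_mul_cot_eq (F := Finf) (L := L * (c0 / π))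
    (continuous_J0.comp (by fun_prop)) (by rw [Finf, mul_div_cancel_left₀ _ pi_ne_zero, hc0])
    (by positivity) fun x hx y hy => by
      refine (hL _ _ (habs hx) (habs hy)).trans_eq ?_
      rw [← sub_div, ← sub_mul, mul_div_assoc, abs_mul, abs_of_pos (div_pos hc pi_pos)]
      ring
  have h' : ∫ θ in (0 : ℝ)..π, Finf θ * ∫ α in (0 : ℝ)..(π - θ), Finf α * Finf (π - θ - α) =
      π / c0 * (π * J1 c0) := by
    rw [← integral_Finf_mul_sin, ← intervalIntegral.integral_const_mul]
    refine intervalIntegral.integral_congr fun θ hθ => ?_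
    rw [Set.uIcc_of_le pi_pos.le] at hθ
    rw [integral_Finf_mul_Finf_sub (sub_nonneg.2 hθ.2)]
    ring
  rw [h'] at h
  rw [show π ^ 2 / (6 * c0) * J1 c0 = π / c0 * (π * J1 c0) / 6 by field_simp, ← h]
  ring
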